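/- arXiv:2411.03059 — 2 statements merged into one kernel-verified Lean document; each statement's English description precedes it below -/
import Mathlib

section
/- For every gradient vector g in ℝ^d and all constants C > 0, r > 0, s > 0, the DP-PSASC scaled gradient Clip(g) = (C / (s·‖g‖ + r/(‖g‖+r)))·g satisfies ‖Clip(g)‖ < C/s. In particular the ℓ2-sensitivity of the DP-PSASC scaling operation is at most C/s. -/
/-- the DP-PSASC scaled gradient has norm strictly below `C/s`,
so the ℓ2-sensitivity of the scaling operation is at most `C/s`. -/
theorem dp_psasc_sensitivity (d : ℕ) (g : EuclideanSpace ℝ (Fin d))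
    (C r s : ℝ) (hC : 0 < C) (hr : 0 < r) (hs : 0 < s) :
    ‖(C / (s * ‖g‖ + r / (‖g‖ + r))) • g‖ < C / s := by
  have hq : 0 < r / (‖g‖ + r) := by positivity
  have hD : 0 < s * ‖g‖ + r / (‖g‖ + r) := by positivity
  rw [norm_smul, Real.norm_of_nonneg (by positivity), div_mul_eq_mul_div, div_lt_div_iff₀ hD hs,
    mul_assoc]
  gcongr
  linarith
end

section
/- Let r > 0 and s > 0 with s·r ≤ 1. Then for every t ≥ 0, s·t + r/(t+r) ≥ 2·√(s·r) − s·r = 1 − (1 − √(s·r))². Consequently, for every gradient norm t = ‖g‖ ≥ 0 and every C > 0, the DP-PSASC weight satisfies w_s(g) = C/(s·t + r/(t+r)) ≤ C / (1 − (1 − √(s·r))²). -/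
/-- The AM-GM inequality for the two terms `s * u` and `r / u`. -/
theorem two_mul_sqrt_mul_le_mul_add_div {r s u : ℝ} (hr : 0 ≤ r) (hs : 0 < s) (hu : 0 < u) :
    2 * Real.sqrt (s * r) ≤ s * u + r / u := by
  have hq : Real.sqrt (s * r) ^ 2 = s * r := Real.sq_sqrt (by positivity)
  have key : s * u + r / u - 2 * Real.sqrt (s * r) =
      (s * u - Real.sqrt (s * r)) ^ 2 / (s * u) := by
    rw [sub_sq, hq]
    field_simp
    ring
  have : 0 ≤ (s * u - Real.sqrt (s * r)) ^ 2 / (s * u) := by positivity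
  linarith

/-- lower bound on `h(t) = s·t + r/(t+r)` and the resulting
upper bound on the DP-PSASC weight. -/
theorem dp_psasc_weight_upper_bound (r s : ℝ) (hr : 0 < r) (hs : 0 < s)
    (hsr : s * r ≤ 1) :
    (∀ t : ℝ, 0 ≤ t →
      s * t + r / (t + r) ≥ 2 * Real.sqrt (s * r) - s * r) ∧
    (2 * Real.sqrt (s * r) - s * r = 1 - (1 - Real.sqrt (s * r)) ^ 2) ∧
    (∀ C : ℝ, 0 < C → ∀ t : ℝ, 0 ≤ t →
      C / (s * t + r / (t + r)) ≤ C / (1 - (1 - Real.sqrt (s * r)) ^ 2)) := by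
  have hq : Real.sqrt (s * r) ^ 2 = s * r := Real.sq_sqrt (by positivity)
  have hq0 : 0 < Real.sqrt (s * r) := Real.sqrt_pos.2 (by positivity)
  have hq1 : Real.sqrt (s * r) ≤ 1 := Real.sqrt_le_one.2 hsr
  have lower : ∀ t : ℝ, 0 ≤ t →
      s * t + r / (t + r) ≥ 2 * Real.sqrt (s * r) - s * r := by
    intro t ht
    have := two_mul_sqrt_mul_le_mul_add_div hr.le hs (add_pos_of_nonneg_of_pos ht hr)
    linarith
  have eq : 2 * Real.sqrt (s * r) - s * r = 1 - (1 - Real.sqrt (s * r)) ^ 2 := by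
    linear_combination hq
  refine ⟨lower, eq, fun C hC t ht => ?_⟩
  have hpos : 0 < 1 - (1 - Real.sqrt (s * r)) ^ 2 := by nlinarith
  exact div_le_div_of_nonneg_left hC.le hpos (eq ▸ lower t ht)
end
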